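/- Let T be a continuous Archimedean t-norm with additive generator t, and I^T the T-power implication: I^T(x,y) = 1 if x ≤ y, and I^T(x,y) = t(x)/t(y) if x > y. A fuzzy relation R on U satisfies inf_{x,y,z} I^T'(T(R(x,y),R(y,z)), R(x,z)) ≥ ε (where the power implication is generated by t) if and only if T(R(x,y),R(y,z)) ≤ t⁻¹(ε · t(R(x,z))) for all x,y,z ∈ U. -/

import Mathlib

open Set ENNReal

/-- A t-norm on the unit interval (viewed as a binary operation on ℝ). -/
def IsTnorm (T : ℝ → ℝ → ℝ) : Prop :=
  (∀ x ∈ Icc (0:ℝ) 1, ∀ y ∈ Icc (0:ℝ) 1, T x y ∈ Icc (0:ℝ) 1) ∧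
  (∀ x y, T x y = T y x) ∧
  (∀ x y z, T (T x y) z = T x (T y z)) ∧
  (∀ x y z, y ≤ z → T x y ≤ T x z) ∧
  (∀ x ∈ Icc (0:ℝ) 1, T x 1 = x)

/-- A strictly decreasing continuous `t` on `[0,1]` with `t 1 = 0` has a threshold at each
fraction `e * t c`, and its left inverse turns upper bounds on `a` into lower bounds on `t a`. -/
theorem le_leftInverse_mul_iff {t : ℝ → ℝ≥0∞} {tinv : ℝ≥0∞ → ℝ}
    (htcont : ContinuousOn t (Icc (0:ℝ) 1)) (htanti : StrictAntiOn t (Icc (0:ℝ) 1))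
    (ht1 : t 1 = 0) (htinvt : ∀ x ∈ Icc (0:ℝ) 1, tinv (t x) = x)
    {a c : ℝ} (ha : a ∈ Icc (0:ℝ) 1) (hc : c ∈ Icc (0:ℝ) 1) {e : ℝ≥0∞} (he : e ≤ 1) :
    a ≤ tinv (e * t c) ↔ e * t c ≤ t a := by
  have hle : e * t c ≤ t 0 :=
    (mul_le_of_le_one_left' he).trans
      (htanti.antitoneOn (left_mem_Icc.2 zero_le_one) hc hc.1)
  obtain ⟨d, hd, hdt⟩ := intermediate_value_Icc' zero_le_one htcont
    (show e * t c ∈ Icc (t 1) (t 0) from ⟨by simp [ht1], hle⟩)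
  rw [← hdt, htinvt d hd]
  exact (htanti.le_iff_ge hd ha).symm

/-- The power implication from `a` to `c` is at least `e ≤ 1` iff `e * t c ≤ t a`. -/
theorem le_powerImplication_iff {t : ℝ → ℝ≥0∞} (htanti : StrictAntiOn t (Icc (0:ℝ) 1))
    {a c : ℝ} (ha : a ∈ Icc (0:ℝ) 1) (hc : c ∈ Icc (0:ℝ) 1) {e : ℝ≥0∞} (he : e ≤ 1) :
    e ≤ (if a ≤ c then 1 else t a / t c) ↔ e * t c ≤ t a := by
  split_ifs with h
  · exact iff_of_true he
      ((mul_le_of_le_one_left' he).trans (htanti.antitoneOn ha hc h))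
  · have hlt : t a < t c := htanti hc ha (not_le.1 h)
    exact ENNReal.le_div_iff_mul_le (Or.inl hlt.ne_bot) (Or.inr hlt.ne_top)

/-- For a continuous Archimedean t-norm `T` with additive generator `t` and the
`T`-power implication `I^T(x,y) = 1` if `x ≤ y` and `t(x)/t(y)` otherwise, the
relation `R` satisfies `inf_{x,y,z} I^T(T(R(x,y),R(y,z)), R(x,z)) ≥ ε` iff
`T(R(x,y),R(y,z)) ≤ t⁻¹(ε · t(R(x,z)))` for all `x,y,z`. -/
theorem stmt_7 {U : Type*} [Nonempty U]
    (t : ℝ → ℝ≥0∞) (tinv : ℝ≥0∞ → ℝ)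
    (htcont : ContinuousOn t (Icc (0:ℝ) 1))
    (htanti : StrictAntiOn t (Icc (0:ℝ) 1))
    (ht1 : t 1 = 0)
    (htinvt : ∀ x ∈ Icc (0:ℝ) 1, tinv (t x) = x)
    (htinv0 : ∀ s : ℝ≥0∞, t 0 ≤ s → tinv s = 0)
    (htinvmem : ∀ s : ℝ≥0∞, tinv s ∈ Icc (0:ℝ) 1)
    (T : ℝ → ℝ → ℝ) (hT : IsTnorm T)
    (hTgen : ∀ a ∈ Icc (0:ℝ) 1, ∀ b ∈ Icc (0:ℝ) 1,
      T a b = tinv (min (t 0) (t a + t b)))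
    (Ipow : ℝ → ℝ → ℝ≥0∞)
    (hIpow : ∀ a b, Ipow a b = if a ≤ b then 1 else t a / t b)
    (R : U → U → ℝ) (hR : ∀ x y, R x y ∈ Icc (0:ℝ) 1)
    (ε : ℝ) (hε : ε ∈ Ioc (0:ℝ) 1) :
    sInf {v : ℝ≥0∞ | ∃ x y z : U,
        v = Ipow (T (R x y) (R y z)) (R x z)} ≥ ENNReal.ofReal ε ↔
      ∀ x y z : U,
        T (R x y) (R y z) ≤ tinv (ENNReal.ofReal ε * t (R x z)) := by
  have he : ENNReal.ofReal ε ≤ 1 := ENNReal.ofReal_le_one.2 hε.2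
  have key (x y z : U) : ENNReal.ofReal ε ≤ Ipow (T (R x y) (R y z)) (R x z) ↔
      T (R x y) (R y z) ≤ tinv (ENNReal.ofReal ε * t (R x z)) := by
    have ha := hT.1 _ (hR x y) _ (hR y z)
    rw [hIpow, le_powerImplication_iff htanti ha (hR x z) he,
      le_leftInverse_mul_iff htcont htanti ht1 htinvt ha (hR x z) he]
  simp only [← key, ge_iff_le, le_sInf_iff, mem_ofPred_eq]
  constructor
  · exact fun h x y z => h _ ⟨x, y, z, rfl⟩
  · rintro h _ ⟨x, y, z, rfl⟩
    exact h x y z
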